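/- arXiv:2303.10412 — 2 statements merged into one kernel-verified Lean document; each statement's English description precedes it below -/
import Mathlib

section
/- Let N ≥ 2 and let Ω₁, Ω₂ be bounded open convex subsets of ℝ^N with closure(Ω₁) ⊆ Ω₂, and set Ω = Ω₂ \ closure(Ω₁). Let M > 0 and 0 < μ₁ < … < μₙ < M. Let u : ℝ^N → ℝ be continuous on closure(Ω), continuously differentiable on Ω, with u = 0 on the frontier of Ω₂ and u = M on the frontier of Ω₁, such that at every point x ∈ Ω with u(x) ∉ {μ₁,…,μₙ}, u is twice differentiable at x and Δu(x) = #{i : μᵢ < u(x)} ≥ 0, and such that for every s ∈ (0,M) the set closure(Ω₁) ∪ {x ∈ Ω : u(x) ≥ s} is convex. Then for every s ∈ (0,M) and every x₀ ∈ Ω with u(x₀) = s, the Fréchet derivative of u at x₀ is nonzero: ∇u(x₀) ≠ 0. -/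
/-- The Laplacian of `u : ℝ^N → ℝ` at `x`, as the trace of the second derivative. -/
noncomputable def lap {N : ℕ} (u : EuclideanSpace ℝ (Fin N) → ℝ)
    (x : EuclideanSpace ℝ (Fin N)) : ℝ :=
  ∑ i : Fin N, fderiv ℝ (fderiv ℝ u) x (EuclideanSpace.single i 1) (EuclideanSpace.single i 1)

/-- The second derivative is nonpositive at a local maximum. -/
theorem IsLocalMax.deriv_deriv_nonpos {f : ℝ → ℝ} {a : ℝ} (h : IsLocalMax f a)
    (hc : ContinuousAt f a) : deriv (deriv f) a ≤ 0 := by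
  by_contra! hpos
  have hmin : IsLocalMin f a := isLocalMin_of_deriv_deriv_pos hpos h.deriv_eq_zero hc
  have hconst : f =ᶠ[nhds a] fun _ => f a := by
    filter_upwards [h, hmin] with y h₁ h₂ using le_antisymm h₁ h₂
  rw [hconst.deriv.deriv_eq] at hpos
  simp at hpos

/-- If `u` lies below a parabola along the line through `p` in direction `e`, touching at `p`,
then its second derivative in direction `e` is bounded by that of the parabola. -/
theorem fderiv_fderiv_apply_le_of_eventually_le {E : Type*} [NormedAddCommGroup E]
    [NormedSpace ℝ E] {u : E → ℝ} {p e : E} {b c : ℝ}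
    (hd : ∀ᶠ y in nhds p, DifferentiableAt ℝ u y)
    (hd2 : DifferentiableAt ℝ (fderiv ℝ u) p)
    (hle : ∀ᶠ τ in nhds (0 : ℝ), u (p + τ • e) + (b * τ + c * τ ^ 2) ≤ u p) :
    fderiv ℝ (fderiv ℝ u) p e e ≤ -(2 * c) := by
  have hline : ∀ τ : ℝ, HasDerivAt (fun τ : ℝ => p + τ • e) e τ := fun τ => by
    simpa using ((hasDerivAt_id τ).smul_const e).const_add p
  have htend : Filter.Tendsto (fun τ : ℝ => p + τ • e) (nhds 0) (nhds p) := by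
    simpa using (hline 0).continuousAt.tendsto
  have hpoly : ∀ τ : ℝ, HasDerivAt (fun τ : ℝ => b * τ + c * τ ^ 2) (b + 2 * c * τ) τ :=
    fun τ =>
      (((hasDerivAt_id τ).const_mul b).add (((hasDerivAt_id τ).pow 2).const_mul c)).congr_deriv
        (by simp only [id_eq, Nat.cast_ofNat]; ring)
  set f : ℝ → ℝ := fun τ => u (p + τ • e) + (b * τ + c * τ ^ 2) with hf
  have hf1 : ∀ᶠ τ in nhds (0 : ℝ),
      HasDerivAt f (fderiv ℝ u (p + τ • e) e + (b + 2 * c * τ)) τ := by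
    filter_upwards [htend.eventually hd] with τ hτ
    exact (hτ.hasFDerivAt.comp_hasDerivAt τ (hline τ)).add (hpoly τ)
  have hf2 : HasDerivAt (fun τ : ℝ => fderiv ℝ u (p + τ • e) e + (b + 2 * c * τ))
      (fderiv ℝ (fderiv ℝ u) p e e + 2 * c) 0 := by
    have hp : p + (0 : ℝ) • e = p := by simp
    have h₁ : HasDerivAt (fun τ : ℝ => fderiv ℝ u (p + τ • e))
        (fderiv ℝ (fderiv ℝ u) p e) 0 := by
      have h₂ : HasFDerivAt (fderiv ℝ u) (fderiv ℝ (fderiv ℝ u) p) (p + (0 : ℝ) • e) := by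
        rw [hp]; exact hd2.hasFDerivAt
      exact h₂.comp_hasDerivAt 0 (hline 0)
    have h₃ : HasDerivAt (fun τ : ℝ => fderiv ℝ u (p + τ • e) e)
        (fderiv ℝ (fderiv ℝ u) p e e) 0 := by
      simpa using h₁.clm_apply (hasDerivAt_const (0 : ℝ) e)
    have h₄ : HasDerivAt (fun τ : ℝ => b + 2 * c * τ) (2 * c) 0 := by
      simpa using ((hasDerivAt_id (0 : ℝ)).const_mul (2 * c)).const_add b
    exact h₃.add h₄
  have hderiv : deriv f =ᶠ[nhds 0] fun τ => fderiv ℝ u (p + τ • e) e + (b + 2 * c * τ) :=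
    hf1.mono fun τ hτ => hτ.deriv
  have hmax : IsLocalMax f 0 := by
    filter_upwards [hle] with τ hτ
    simpa [hf] using hτ
  have := hmax.deriv_deriv_nonpos hf1.self_of_nhds.continuousAt
  rw [hderiv.deriv_eq, hf2.deriv] at this
  linarith

/-- **Hopf boundary point lemma** at a flat boundary: a function which is subharmonic on a half
ball around `x` and smaller there than at `x` has nonzero derivative at `x`. -/
theorem fderiv_ne_zero_of_lt_on_half_ball {N : ℕ} {u : EuclideanSpace ℝ (Fin N) → ℝ}
    {x ν : EuclideanSpace ℝ (Fin N)} {r : ℝ} (hr : 0 < r) (hν : ‖ν‖ = 1)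
    (hd : ∀ z ∈ Metric.ball x r, DifferentiableAt ℝ u z)
    (hd2 : ∀ z ∈ Metric.ball x r, 0 < inner ℝ ν (z - x) →
      DifferentiableAt ℝ (fderiv ℝ u) z ∧ 0 ≤ lap u z)
    (hlt : ∀ z ∈ Metric.ball x r, 0 < inner ℝ ν (z - x) → u z < u x) :
    fderiv ℝ u x ≠ 0 := by
  have hνν : inner ℝ ν ν = (1 : ℝ) := by rw [real_inner_self_eq_norm_sq, hν]; norm_num
  have hle : ∀ z ∈ Metric.ball x r, 0 ≤ inner ℝ ν (z - x) → u z ≤ u x := by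
    intro z hz h0
    have ht : Filter.Tendsto (fun τ : ℝ => z + τ • ν) (nhdsWithin 0 (Set.Ioi 0)) (nhds z) := by
      have : ContinuousAt (fun τ : ℝ => z + τ • ν) 0 := by fun_prop
      simpa using this.tendsto.mono_left nhdsWithin_le_nhds
    refine le_of_tendsto ((hd z hz).continuousAt.tendsto.comp ht) ?_
    filter_upwards [ht.eventually (Metric.isOpen_ball.mem_nhds hz), self_mem_nhdsWithin]
      with τ hτ hτ0
    refine (hlt _ hτ ?_).le
    rw [add_sub_right_comm, inner_add_right, inner_smul_right, hνν]
    have : (0 : ℝ) < τ := hτ0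
    linarith
  set t : EuclideanSpace ℝ (Fin N) → ℝ := fun z => inner ℝ ν (z - x) with ht_def
  set v : EuclideanSpace ℝ (Fin N) → ℝ := fun z => t z + (N + 1) * t z ^ 2 - ‖z - x‖ ^ 2
    with hv_def
  have htc : Continuous t := by fun_prop
  have hvc : Continuous v := by fun_prop
  have hρ : 0 < r / 2 := by positivity
  have hsub : Metric.closedBall x (r / 2) ⊆ Metric.ball x r :=
    Metric.closedBall_subset_ball (by linarith)
  have huc : ContinuousOn u (Metric.closedBall x (r / 2)) := fun z hz =>
    (hd z (hsub hz)).continuousAt.continuousWithinAt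
  obtain ⟨ε, hε, hcap⟩ : ∃ ε > 0, ∀ z ∈ Metric.sphere x (r / 2), 0 ≤ t z →
      u z + ε * v z ≤ u x := by
    set S := Metric.sphere x (r / 2) ∩ {z | 0 ≤ t z} ∩ {z | 0 ≤ v z} with hS
    have hScpt : IsCompact S := ((isCompact_sphere x (r / 2)).inter_right
      (isClosed_le continuous_const htc)).inter_right (isClosed_le continuous_const hvc)
    have hSlt : ∀ z ∈ S, u z < u x := by
      rintro z ⟨⟨hz, h0⟩, hv0⟩
      refine hlt z (hsub (Metric.sphere_subset_closedBall hz)) (lt_of_le_of_ne h0 fun h => ?_)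
      have hv0' : 0 ≤ v z := hv0
      have hzn : ‖z - x‖ = r / 2 := by simpa [dist_eq_norm] using hz
      have ht0 : t z = 0 := h.symm
      simp only [hv_def, ht0, hzn] at hv0'
      nlinarith
    rcases S.eq_empty_or_nonempty with hSe | hSne
    · refine ⟨1, one_pos, fun z hz h0 => ?_⟩
      have hv0 : v z < 0 := by
        by_contra! h
        exact (Set.eq_empty_iff_forall_notMem.1 hSe z) ⟨⟨hz, h0⟩, h⟩
      have := hle z (hsub (Metric.sphere_subset_closedBall hz)) h0
      linarith
    · obtain ⟨z₁, hz₁, hmax₁⟩ := hScpt.exists_isMaxOn hSne (huc.mono fun z hz =>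
        Metric.sphere_subset_closedBall hz.1.1)
      obtain ⟨z₂, hz₂, hmax₂⟩ := hScpt.exists_isMaxOn hSne hvc.continuousOn
      have hδ : 0 < u x - u z₁ := sub_pos.2 (hSlt z₁ hz₁)
      have hC : 0 < v z₂ + 1 := by
        have : 0 ≤ v z₂ := hz₂.2
        linarith
      refine ⟨(u x - u z₁) / (v z₂ + 1), by positivity, fun z hz h0 => ?_⟩
      rcases le_or_gt 0 (v z) with hv0 | hv0
      · have hzS : z ∈ S := ⟨⟨hz, h0⟩, hv0⟩
        have h₁ : u z ≤ u z₁ := hmax₁ hzS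
        have h₂ : v z ≤ v z₂ := hmax₂ hzS
        have : (u x - u z₁) / (v z₂ + 1) * v z ≤ u x - u z₁ := by
          rw [div_mul_eq_mul_div, div_le_iff₀ hC]
          nlinarith
        linarith
      · have h₁ := hle z (hsub (Metric.sphere_subset_closedBall hz)) h0
        have : (u x - u z₁) / (v z₂ + 1) * v z ≤ 0 :=
          mul_nonpos_of_nonneg_of_nonpos (by positivity) hv0.le
        linarith
  have hbarrier : ∀ z ∈ Metric.closedBall x (r / 2), 0 ≤ t z → u z + ε * v z ≤ u x := by
    set D := Metric.closedBall x (r / 2) ∩ {z | 0 ≤ t z} with hD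
    have hDcpt : IsCompact D := (isCompact_closedBall x (r / 2)).inter_right
      (isClosed_le continuous_const htc)
    have hxD : x ∈ D := ⟨Metric.mem_closedBall_self hρ.le, by simp [ht_def]⟩
    obtain ⟨p, hpD, hpmax⟩ := hDcpt.exists_isMaxOn ⟨x, hxD⟩
      ((huc.mono Set.inter_subset_left).add (hvc.continuousOn.const_mul ε))
    have hpmax' : ∀ z ∈ D, u z + ε * v z ≤ u p + ε * v p := fun z hz => hpmax hz
    suffices hp : u p + ε * v p ≤ u x from fun z hz h0 => (hpmax' z ⟨hz, h0⟩).trans hp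
    have hpt : 0 ≤ t p := hpD.2
    rcases eq_or_lt_of_le hpt with ht0 | htpos
    · have h₁ := hle p (hsub hpD.1) hpt
      have h₂ : v p ≤ 0 := by
        simp only [hv_def, ← ht0]
        nlinarith [sq_nonneg ‖p - x‖]
      nlinarith
    rcases eq_or_lt_of_le (Metric.mem_closedBall.1 hpD.1) with hps | hpb
    · exact hcap p hps hpt
    exfalso
    have hpball : p ∈ Metric.ball x (r / 2) := hpb
    have hpr : p ∈ Metric.ball x r := hsub hpD.1
    obtain ⟨hdp, hlap⟩ := hd2 p hpr htpos
    have hDp : D ∈ nhds p := Filter.inter_mem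
      (Filter.mem_of_superset (Metric.isOpen_ball.mem_nhds hpball) Metric.ball_subset_closedBall)
      (Filter.mem_of_superset ((isOpen_lt continuous_const htc).mem_nhds htpos)
        fun z (hz : 0 < t z) => hz.le)
    have hcoord : ∀ i : Fin N, fderiv ℝ (fderiv ℝ u) p (EuclideanSpace.single i 1)
        (EuclideanSpace.single i 1) ≤ -(2 * (ε * ((N + 1) * ν i ^ 2 - 1))) := by
      intro i
      set e : EuclideanSpace ℝ (Fin N) := EuclideanSpace.single i 1 with he
      have hνe : inner ℝ ν e = ν i := by simp [he, EuclideanSpace.inner_single_right]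
      have hee : inner ℝ e e = (1 : ℝ) := by rw [real_inner_self_eq_norm_sq]; simp [he]
      refine fderiv_fderiv_apply_le_of_eventually_le
        (b := ε * (ν i + 2 * (N + 1) * t p * ν i - 2 * inner ℝ (p - x) e))
        (Filter.mem_of_superset (Metric.isOpen_ball.mem_nhds hpr) hd) hdp ?_
      have hcont : ContinuousAt (fun τ : ℝ => p + τ • e) 0 := by fun_prop
      have hDτ : ∀ᶠ τ in nhds (0 : ℝ), p + τ • e ∈ D :=
        hcont.tendsto.eventually (by simpa using hDp)
      filter_upwards [hDτ] with τ hτ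
      have h₁ := hpmax' _ hτ
      have ht' : t (p + τ • e) = t p + τ * ν i := by
        simp only [ht_def]
        rw [add_sub_right_comm, inner_add_right, inner_smul_right, hνe]
      have hn' : ‖p + τ • e - x‖ ^ 2 = ‖p - x‖ ^ 2 + 2 * τ * inner ℝ (p - x) e + τ ^ 2 := by
        rw [add_sub_right_comm, ← real_inner_self_eq_norm_sq, real_inner_add_add_self,
          inner_smul_right, real_inner_smul_left, inner_smul_right, hee,
          real_inner_self_eq_norm_sq]
        ring
      simp only [hv_def, ht', hn'] at h₁
      linear_combination h₁
    have hsum : lap u p ≤ ∑ i : Fin N, -(2 * (ε * ((N + 1) * ν i ^ 2 - 1))) :=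
      Finset.sum_le_sum fun i _ => hcoord i
    have hνsum : ∑ i : Fin N, ν i ^ 2 = 1 := by
      rw [← EuclideanSpace.real_norm_sq_eq, hν]; norm_num
    have hval : ∑ i : Fin N, -(2 * (ε * ((N + 1) * ν i ^ 2 - 1))) = -(2 * ε) := by
      rw [Finset.sum_neg_distrib, ← Finset.mul_sum, ← Finset.mul_sum, Finset.sum_sub_distrib,
        ← Finset.mul_sum, hνsum]
      simp
    linarith
  intro hzero
  have hdx := hd x (Metric.mem_ball_self hr)
  have hline : HasDerivAt (fun τ : ℝ => u (x + τ • ν)) 0 0 := by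
    have h₁ : HasDerivAt (fun τ : ℝ => x + τ • ν) ν 0 := by
      simpa using ((hasDerivAt_id (0 : ℝ)).smul_const ν).const_add x
    have h₂ : HasFDerivAt u (0 : EuclideanSpace ℝ (Fin N) →L[ℝ] ℝ) (x + (0 : ℝ) • ν) := by
      simpa [hzero] using hdx.hasFDerivAt
    exact h₂.comp_hasDerivAt 0 h₁
  have hlim := hline.tendsto_slope_zero_right
  have : (0 : ℝ) ≤ -ε := by
    refine le_of_tendsto hlim ?_
    filter_upwards [Ioo_mem_nhdsGT hρ] with τ hτ
    have hτ0 : 0 < τ := hτ.1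
    have htτ : t (x + τ • ν) = τ := by simp [ht_def, inner_smul_right, hν]
    have hnτ : ‖x + τ • ν - x‖ = τ := by simp [norm_smul, hν, abs_of_pos hτ0]
    have h₁ := hbarrier (x + τ • ν) (by
      rw [Metric.mem_closedBall, dist_eq_norm, hnτ]; exact hτ.2.le) (by rw [htτ]; exact hτ0.le)
    have h₂ : τ ≤ v (x + τ • ν) := by
      simp only [hv_def, htτ, hnτ]
      have : (0 : ℝ) ≤ N * τ ^ 2 := by positivity
      linarith
    have h₃ : u (x + τ • ν) - u x ≤ -ε * τ := by nlinarith
    simp only [zero_add, zero_smul, add_zero, smul_eq_mul]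
    rw [inv_mul_le_iff₀ hτ0]
    linarith
  linarith

/-- A convex set in a finite-dimensional space has a supporting functional at each of its
non-interior points. -/
theorem Convex.exists_supporting_functional {E : Type*} [NormedAddCommGroup E] [NormedSpace ℝ E]
    [FiniteDimensional ℝ E] {K : Set E} (hK : Convex ℝ K) {x : E} (hxK : x ∈ K)
    (hx : x ∉ interior K) : ∃ g : E →L[ℝ] ℝ, g ≠ 0 ∧ ∀ y ∈ K, g y ≤ g x := by
  rcases (interior K).eq_empty_or_nonempty with he | hne
  · have hspan : affineSpan ℝ K ≠ ⊤ := fun h => by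
      rw [← hK.interior_nonempty_iff_affineSpan_eq_top, he] at h
      exact Set.not_nonempty_empty h
    have hdir : (affineSpan ℝ K).direction < ⊤ := by
      refine lt_top_iff_ne_top.2 fun h => hspan ?_
      exact (AffineSubspace.direction_eq_top_iff_of_nonempty
        ⟨x, subset_affineSpan ℝ K hxK⟩).1 h
    obtain ⟨f, hf0, hf⟩ := Submodule.exists_le_ker_of_lt_top _ hdir
    refine ⟨LinearMap.toContinuousLinearMap f, by simpa using hf0, fun y hy => ?_⟩
    have h₁ : y - x ∈ (affineSpan ℝ K).direction :=
      AffineSubspace.vsub_mem_direction (subset_affineSpan ℝ K hy) (subset_affineSpan ℝ K hxK)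
    have h₂ : f (y - x) = 0 := hf h₁
    rw [map_sub] at h₂
    simp only [LinearMap.coe_toContinuousLinearMap']
    linarith
  · obtain ⟨g, hg⟩ := geometric_hahn_banach_open_point hK.interior isOpen_interior hx
    refine ⟨g, ?_, fun y hy => ?_⟩
    · rintro rfl
      obtain ⟨y, hy⟩ := hne
      simpa using hg y hy
    · have hycl : y ∈ closure (interior K) := by
        rw [hK.closure_interior_eq_closure_of_nonempty_interior hne]
        exact subset_closure hy
      exact closure_minimal (fun z hz => (hg z hz).le)
        (isClosed_le g.continuous continuous_const) hycl

/-- Core of Proposition 2.2: for a solution `u` of problem (1) in the convex ring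
`Ω = Ω₂ \ closure Ω₁` whose superlevel sets are convex, the gradient of `u` does not
vanish on any level set `Γ_s(u)`, `s ∈ (0, M)`. -/
theorem stmt3 (N n : ℕ) (hN : 2 ≤ N)
    (Ω₁ Ω₂ : Set (EuclideanSpace ℝ (Fin N)))
    (hΩ₁o : IsOpen Ω₁) (hΩ₂o : IsOpen Ω₂)
    (hΩ₁b : Bornology.IsBounded Ω₁) (hΩ₂b : Bornology.IsBounded Ω₂)
    (hΩ₁c : Convex ℝ Ω₁) (hΩ₂c : Convex ℝ Ω₂)
    (hsub : closure Ω₁ ⊆ Ω₂)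
    (M : ℝ) (hM : 0 < M)
    (μ : Fin n → ℝ) (hμmono : StrictMono μ)
    (hμ0 : ∀ i, 0 < μ i) (hμM : ∀ i, μ i < M)
    (u : EuclideanSpace ℝ (Fin N) → ℝ)
    (hu_cont : ContinuousOn u (closure (Ω₂ \ closure Ω₁)))
    (hu1 : ContDiffOn ℝ 1 u (Ω₂ \ closure Ω₁))
    (hbd2 : ∀ x ∈ frontier Ω₂, u x = 0)
    (hbd1 : ∀ x ∈ frontier Ω₁, u x = M)
    (heq : ∀ x ∈ Ω₂ \ closure Ω₁, (∀ i, u x ≠ μ i) →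
      DifferentiableAt ℝ (fderiv ℝ u) x ∧
      lap u x = (Finset.univ.filter fun i => μ i < u x).card)
    (hconv : ∀ s ∈ Set.Ioo (0 : ℝ) M,
      Convex ℝ (closure Ω₁ ∪ {x ∈ Ω₂ \ closure Ω₁ | s ≤ u x})) :
    ∀ s ∈ Set.Ioo (0 : ℝ) M, ∀ x₀ ∈ Ω₂ \ closure Ω₁, u x₀ = s →
      fderiv ℝ u x₀ ≠ 0 := by
  intro s hs x₀ hx₀ hux₀
  obtain ⟨hs0, hsM⟩ := hs
  set Ω : Set (EuclideanSpace ℝ (Fin N)) := Ω₂ \ closure Ω₁ with hΩ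
  have hΩo : IsOpen Ω := hΩ₂o.sdiff isClosed_closure
  have huΩ : ∀ x ∈ Ω, ContinuousAt u x := fun x hx =>
    hu1.continuousOn.continuousAt (hΩo.mem_nhds hx)
  set K : Set (EuclideanSpace ℝ (Fin N)) := closure Ω₁ ∪ {x ∈ Ω | s ≤ u x} with hK
  have hKconv : Convex ℝ K := hconv s ⟨hs0, hsM⟩
  have hboundary : ∀ x ∈ Ω, u x = s → x ∉ interior K → fderiv ℝ u x ≠ 0 := by
    intro x hx hux hxK
    obtain ⟨g, hg0, hg⟩ := hKconv.exists_supporting_functional (Or.inr ⟨hx, hux.ge⟩) hxK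
    set w : EuclideanSpace ℝ (Fin N) := (InnerProductSpace.toDual ℝ _).symm g with hw
    have hwg : ∀ y, inner ℝ w y = g y := fun y => by
      rw [hw, InnerProductSpace.toDual_symm_apply]
    have hw0 : w ≠ 0 := by simpa [hw] using hg0
    have hwn : 0 < ‖w‖ := norm_pos_iff.2 hw0
    have hev : ∀ᶠ z in nhds x, z ∈ Ω ∧ ∀ i, μ i < s → μ i < u z := by
      refine Filter.Eventually.and (hΩo.mem_nhds hx) (Filter.eventually_all.2 fun i => ?_)
      by_cases hi : μ i < s
      · filter_upwards [(huΩ x hx).eventually (lt_mem_nhds (hux.symm ▸ hi))] with z hz _ using hz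
      · exact Filter.Eventually.of_forall fun z h => absurd h hi
    obtain ⟨r, hr, hball⟩ := Metric.eventually_nhds_iff_ball.1 hev
    have hlt : ∀ z ∈ Metric.ball x r, 0 < inner ℝ (‖w‖⁻¹ • w) (z - x) → u z < u x := by
      intro z hz hpos
      rw [real_inner_smul_left, hwg, map_sub] at hpos
      have hpos' : 0 < g z - g x := pos_of_mul_pos_right hpos (by positivity)
      by_contra! h
      have := hg z (Or.inr ⟨(hball z hz).1, hux ▸ h⟩)
      linarith
    refine fderiv_ne_zero_of_lt_on_half_ball hr (norm_smul_inv_norm hw0) (fun z hz => ?_)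
      (fun z hz hpos => ?_) hlt
    · exact (hu1.contDiffAt (hΩo.mem_nhds (hball z hz).1)).differentiableAt one_ne_zero
    · have hus : u z < s := hux ▸ hlt z hz hpos
      obtain ⟨h₁, h₂⟩ := heq z (hball z hz).1 fun i hi =>
        ((hball z hz).2 i (hi ▸ hus)).ne hi.symm
      exact ⟨h₁, h₂ ▸ Nat.cast_nonneg _⟩
  by_cases hint : x₀ ∈ interior K
  swap
  · exact hboundary x₀ hx₀ hux₀ hint
  exfalso
  set L : Set (EuclideanSpace ℝ (Fin N)) := closure Ω₁ ∪ {x ∈ Ω | s < u x} with hL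
  have hx₀L : x₀ ∉ L := by
    rintro (h | h)
    · exact hx₀.2 h
    · exact h.2.ne' hux₀
  have hLmem : ∀ a ∈ L, ∃ s' ∈ Set.Ioo s M, a ∈ closure Ω₁ ∪ {x ∈ Ω | s' ≤ u x} := by
    rintro a (ha | ⟨ha, hua⟩)
    · exact ⟨(s + M) / 2, ⟨by linarith, by linarith⟩, Or.inl ha⟩
    · exact ⟨min (u a) ((s + M) / 2), ⟨lt_min hua (by linarith),
        (min_le_right _ _).trans_lt (by linarith)⟩, Or.inr ⟨ha, min_le_left _ _⟩⟩
  have hmono : ∀ {s₁ s₂ : ℝ}, s₁ ≤ s₂ →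
      closure Ω₁ ∪ {x ∈ Ω | s₂ ≤ u x} ⊆ closure Ω₁ ∪ {x ∈ Ω | s₁ ≤ u x} := fun h =>
    Set.union_subset_union_right _ fun x hx => ⟨hx.1, h.trans hx.2⟩
  have hLconv : Convex ℝ L := by
    rw [convex_iff_segment_subset]
    intro a ha b hb
    obtain ⟨sa, hsa, ha'⟩ := hLmem a ha
    obtain ⟨sb, hsb, hb'⟩ := hLmem b hb
    have hmin : s < min sa sb := lt_min hsa.1 hsb.1
    refine ((hconv (min sa sb) ⟨hs0.trans hmin, (min_le_left _ _).trans_lt hsa.2⟩).segment_subset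
      (hmono (min_le_left _ _) ha') (hmono (min_le_right _ _) hb')).trans ?_
    exact Set.union_subset_union_right _ fun x hx => ⟨hx.1, hmin.trans_le hx.2⟩
  have hfront : ∀ x ∈ frontier Ω₁, ∀ᶠ y in nhds x, y ∈ L := by
    intro x hx
    have hxcl : x ∈ closure Ω₁ := frontier_subset_closure hx
    by_cases hxΩ : x ∈ closure Ω
    · have h₁ : ∀ᶠ y in nhdsWithin x (closure Ω), s < u y :=
        (hu_cont x hxΩ).eventually (lt_mem_nhds (by rw [hbd1 x hx]; exact hsM))
      filter_upwards [eventually_nhdsWithin_iff.1 h₁, hΩ₂o.mem_nhds (hsub hxcl)] with y hy hy₂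
      by_cases hy₁ : y ∈ closure Ω₁
      · exact Or.inl hy₁
      · exact Or.inr ⟨⟨hy₂, hy₁⟩, hy (subset_closure ⟨hy₂, hy₁⟩)⟩
    · filter_upwards [isClosed_closure.isOpen_compl.mem_nhds hxΩ, hΩ₂o.mem_nhds (hsub hxcl)]
        with y hy hy₂
      by_contra h
      exact hy (subset_closure ⟨hy₂, fun hy₁ => h (Or.inl hy₁)⟩)
  have hLopen : IsOpen L := by
    rw [isOpen_iff_eventually]
    rintro x (hx | ⟨hx, hux⟩)
    · by_cases hx₁ : x ∈ Ω₁
      · filter_upwards [hΩ₁o.mem_nhds hx₁] with y hy using Or.inl (subset_closure hy)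
      · exact hfront x ⟨hx, by rwa [hΩ₁o.interior_eq]⟩
    · filter_upwards [hΩo.mem_nhds hx, (huΩ x hx).eventually (lt_mem_nhds hux)] with y hy hy'
      exact Or.inr ⟨hy, hy'⟩
  obtain ⟨f, e, hfe, hf⟩ : ∃ (f : EuclideanSpace ℝ (Fin N) →L[ℝ] ℝ)
      (e : EuclideanSpace ℝ (Fin N)), 0 < f e ∧ ∀ y ∈ L, f y < f x₀ := by
    rcases L.eq_empty_or_nonempty with hLe | ⟨y, hy⟩
    · refine ⟨EuclideanSpace.proj (⟨0, by omega⟩ : Fin N),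
        EuclideanSpace.single ⟨0, by omega⟩ 1, by simp, by simp [hLe]⟩
    · obtain ⟨f, hf⟩ := geometric_hahn_banach_open_point hLconv hLopen hx₀L
      exact ⟨f, x₀ - y, by rw [map_sub]; linarith [hf y hy], hf⟩
  have hΩΩ₂ : Ω ⊆ Ω₂ := Set.sdiff_subset
  have hKΩ₂ : K ⊆ Ω₂ := Set.union_subset hsub fun x hx => hx.1.1
  have hKclosed : IsClosed K := by
    refine isClosed_of_closure_subset fun x hx => ?_
    rw [hK, closure_union, closure_closure] at hx
    rcases hx with hx | hx
    · exact Or.inl hx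
    have hxΩ : x ∈ closure Ω := closure_mono (fun y hy => hy.1) hx
    have hsx : s ≤ u x := by
      have : (nhdsWithin x {x ∈ Ω | s ≤ u x}).NeBot := mem_closure_iff_nhdsWithin_neBot.1 hx
      refine ge_of_tendsto ((hu_cont x hxΩ).mono_left
        (nhdsWithin_mono x ((Set.sep_subset Ω (s ≤ u ·)).trans subset_closure))) ?_
      filter_upwards [self_mem_nhdsWithin] with y hy using hy.2
    by_cases hx₁ : x ∈ closure Ω₁
    · exact Or.inl hx₁
    by_cases hx₂ : x ∈ Ω₂
    · exact Or.inr ⟨⟨hx₂, hx₁⟩, hsx⟩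
    have := hbd2 x ⟨closure_mono hΩΩ₂ hxΩ, by rwa [hΩ₂o.interior_eq]⟩
    linarith
  have he0 : e ≠ 0 := by
    rintro rfl
    simp at hfe
  set T : Set ℝ := {τ | 0 ≤ τ ∧ x₀ + τ • e ∈ K} with hT
  have hline : Continuous fun τ : ℝ => x₀ + τ • e := by fun_prop
  have hTclosed : IsClosed T := (isClosed_le continuous_const continuous_id).inter
    (hKclosed.preimage hline)
  have hT0 : (0 : ℝ) ∈ T := ⟨le_rfl, by simpa using interior_subset hint⟩
  obtain ⟨R, hR⟩ := (hΩ₂b.subset hKΩ₂).exists_norm_le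
  have hTbdd : BddAbove T := by
    refine ⟨(R + ‖x₀‖) / ‖e‖, fun τ hτ => ?_⟩
    rw [le_div_iff₀ (norm_pos_iff.2 he0)]
    have h₁ : ‖τ • e‖ = τ * ‖e‖ := by rw [norm_smul, Real.norm_of_nonneg hτ.1]
    have h₂ : ‖τ • e‖ ≤ ‖x₀ + τ • e‖ + ‖x₀‖ := by
      simpa using norm_sub_le (x₀ + τ • e) x₀
    linarith [hR _ hτ.2]
  have hτT : sSup T ∈ T := hTclosed.csSup_mem ⟨0, hT0⟩ hTbdd
  set τ := sSup T with hτdef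
  have hτpos : 0 < τ := by
    have h₁ : ∀ᶠ t in nhdsWithin (0 : ℝ) (Set.Ioi 0), x₀ + t • e ∈ K :=
      (hline.tendsto' 0 x₀ (by simp)).mono_left nhdsWithin_le_nhds
        (mem_interior_iff_mem_nhds.1 hint)
    obtain ⟨t, ht, ht0⟩ := (h₁.and self_mem_nhdsWithin).exists
    have ht0' : 0 < t := ht0
    exact ht0'.trans_le (le_csSup hTbdd ⟨ht0'.le, ht⟩)
  set x₁ := x₀ + τ • e with hx₁
  have hfx₁ : f x₀ < f x₁ := by
    rw [hx₁, map_add, map_smul, smul_eq_mul]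
    have := mul_pos hτpos hfe
    linarith
  have hx₁L : x₁ ∉ L := fun h => (hf x₁ h).not_gt hfx₁
  have hx₁Ω : x₁ ∈ Ω ∧ u x₁ = s := by
    rcases hτT.2 with h | h
    · exact absurd (Or.inl h) hx₁L
    · exact ⟨h.1, le_antisymm (not_lt.1 fun h' => hx₁L (Or.inr ⟨h.1, h'⟩)) h.2⟩
  have hx₁int : x₁ ∉ interior K := by
    intro h
    have h₁ : ∀ᶠ t in nhdsWithin τ (Set.Ioi τ), x₀ + t • e ∈ K :=
      (hline.tendsto' τ x₁ rfl).mono_left nhdsWithin_le_nhds (mem_interior_iff_mem_nhds.1 h)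
    obtain ⟨t, ht, htτ⟩ := (h₁.and self_mem_nhdsWithin).exists
    have htτ' : τ < t := htτ
    exact (le_csSup hTbdd (show t ∈ T from ⟨(hτpos.trans htτ').le, ht⟩)).not_gt htτ'
  have hmax : IsLocalMax u x₁ := by
    filter_upwards [hΩo.mem_nhds hx₁Ω.1, f.continuous.continuousAt.eventually (lt_mem_nhds hfx₁)]
      with y hy hfy
    rw [hx₁Ω.2]
    exact not_lt.1 fun h => (hf y (Or.inr ⟨hy, h⟩)).not_gt hfy
  exact hboundary x₁ hx₁Ω.1 hx₁Ω.2 hx₁int hmax.fderiv_eq_zero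
end

section
/- Let N ≥ 2 and let Ω₁, Ω₂ be bounded open convex subsets of ℝ^N with closure(Ω₁) ⊆ Ω₂, and set Ω = Ω₂ \ closure(Ω₁). Let M > 0 and 0 < μ₁ < … < μₙ < M. Let u : ℝ^N → ℝ be continuous on closure(Ω) and continuously differentiable on Ω with α-Hölder continuous gradient for some α ∈ (0,1), with u = 0 on the frontier of Ω₂ and u = M on the frontier of Ω₁, such that at every x ∈ Ω with u(x) ∉ {μ₁,…,μₙ}, u is twice differentiable at x with Δu(x) = #{i : μᵢ < u(x)}, and such that for every s ∈ (0,M) the set closure(Ω₁) ∪ {x ∈ Ω : u(x) ≥ s} is convex. Then for each i ∈ {1,…,n}, the free boundary Γ_{μᵢ}(u) = {x ∈ Ω : u(x) = μᵢ} is locally the graph of a continuously differentiable function: for every x₀ ∈ Γ_{μᵢ}(u) there exist an open neighborhood V of x₀ in Ω, a unit vector e ∈ ℝ^N, and a C¹ function ψ defined on an open subset of the hyperplane e^⊥, such that Γ_{μᵢ}(u) ∩ V = {y + ψ(y)·e : y ∈ dom ψ} ∩ V. -/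
open scoped RealInnerProductSpace

open Set Filter Topology

/-- A convex set in a finite-dimensional inner product space is supported by a hyperplane at
every point outside its interior. -/
theorem Convex.exists_unit_inner_sub_nonpos {E : Type*} [NormedAddCommGroup E]
    [InnerProductSpace ℝ E] [FiniteDimensional ℝ E] [Nontrivial E] {C : Set E}
    (hC : Convex ℝ C) {x : E} (hx : x ∉ interior C) :
    ∃ e : E, ‖e‖ = 1 ∧ ∀ y ∈ C, ⟪y - x, e⟫ ≤ 0 := by
  have key : ∃ f : E →L[ℝ] ℝ, f ≠ 0 ∧ ∀ y ∈ C, f y ≤ f x := by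
    by_cases hne : (interior C).Nonempty
    · exact geometric_hahn_banach_of_nonempty_interior_point hC hx hne
    · have hspan : affineSpan ℝ C ≠ ⊤ := fun h =>
        hne (hC.interior_nonempty_iff_affineSpan_eq_top.2 h)
      rcases C.eq_empty_or_nonempty with rfl | ⟨a, ha⟩
      · obtain ⟨v, hv⟩ := exists_ne (0 : E)
        exact ⟨innerSL ℝ v, fun h => hv (by
          simpa using congrArg (fun f : E →L[ℝ] ℝ => f v) h), by simp⟩
      · have hdir : (affineSpan ℝ C).direction < ⊤ := by
          rw [lt_top_iff_ne_top]
          intro h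
          exact hspan ((AffineSubspace.direction_eq_top_iff_of_nonempty
            ⟨a, subset_affineSpan ℝ C ha⟩).1 h)
        obtain ⟨g, hg0, hg⟩ := Submodule.exists_le_ker_of_lt_top _ hdir
        have hconst : ∀ y ∈ C, g y = g a := by
          intro y hy
          have : y - a ∈ (affineSpan ℝ C).direction :=
            AffineSubspace.vsub_mem_direction (subset_affineSpan ℝ C hy) (subset_affineSpan ℝ C ha)
          have := hg this
          rw [LinearMap.mem_ker, map_sub] at this
          linarith
        have hg0' : LinearMap.toContinuousLinearMap g ≠ 0 := by
          simpa using hg0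
        rcases le_total (g a) (g x) with h | h
        · exact ⟨LinearMap.toContinuousLinearMap g, hg0', fun y hy => by
            simpa [hconst y hy] using h⟩
        · exact ⟨-LinearMap.toContinuousLinearMap g, neg_ne_zero.2 hg0', fun y hy => by
            simpa [hconst y hy] using h⟩
  obtain ⟨f, hf0, hf⟩ := key
  set v := (InnerProductSpace.toDual ℝ E).symm f with hv
  have hv0 : v ≠ 0 := by simpa [hv] using hf0
  have hvf : ∀ z, ⟪v, z⟫ = f z := fun z => by simp [hv]
  refine ⟨‖v‖⁻¹ • v, norm_smul_inv_norm hv0, fun y hy => ?_⟩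
  rw [real_inner_smul_right, real_inner_comm, hvf, map_sub]
  exact mul_nonpos_of_nonneg_of_nonpos (by positivity) (by linarith [hf y hy])

/-- Near a point at which the derivative of a `C¹` function in the direction `e` does not vanish,
its level set is the graph of a `C¹` function over an open subset of the hyperplane `e^⊥`. -/
theorem exists_levelSet_eq_graph {E : Type*} [NormedAddCommGroup E]
    [InnerProductSpace ℝ E] [CompleteSpace E] {u : E → ℝ} {Ω : Set E} (hΩ : IsOpen Ω) {x₀ e : E}
    (hx₀ : x₀ ∈ Ω) (hu : ContDiffAt ℝ 1 u x₀) (he : ‖e‖ = 1) (hd : fderiv ℝ u x₀ e ≠ 0) (c : ℝ) :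
    ∃ V : Set E, IsOpen V ∧ x₀ ∈ V ∧ V ⊆ Ω ∧ ∃ U : Set E, IsOpen U ∧
      ∃ ψ : E → ℝ, ContDiffOn ℝ 1 ψ (U ∩ {y : E | ⟪y, e⟫ = 0}) ∧
        {x ∈ Ω | u x = c} ∩ V =
          {p : E | ∃ y ∈ U ∩ {y : E | ⟪y, e⟫ = 0}, p = y + ψ y • e} ∩ V := by
  have hee : ⟪e, e⟫ = 1 := by rw [real_inner_self_eq_norm_sq, he]; norm_num
  set d := fderiv ℝ u x₀
  set Φ : E → E := fun x => x - ⟪x, e⟫ • e + u x • e with hΦ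
  have hΦe : ∀ x, ⟪Φ x, e⟫ = u x := fun x => by
    simp [hΦ, inner_add_left, inner_sub_left, real_inner_smul_left, he]
  let L : E ≃L[ℝ] E := ContinuousLinearEquiv.equivOfInverse
    (ContinuousLinearMap.id ℝ E + (d - innerSL ℝ e).smulRight e)
    (ContinuousLinearMap.id ℝ E + ((d e)⁻¹ • (innerSL ℝ e - d)).smulRight e)
    (fun h => by
      simp only [add_apply, ContinuousLinearMap.smulRight_apply, sub_apply, smul_apply,
        innerSL_apply_apply, ContinuousLinearMap.id_apply, hee, map_add, map_smul, smul_eq_mul]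
      match_scalars
      · ring
      · field_simp
        ring)
    (fun h => by
      simp only [add_apply, ContinuousLinearMap.smulRight_apply, sub_apply, smul_apply,
        innerSL_apply_apply, ContinuousLinearMap.id_apply, hee, map_add, map_smul, smul_eq_mul]
      match_scalars
      · ring
      · field_simp
        ring)
  have hΦd : HasFDerivAt Φ (L : E →L[ℝ] E) x₀ := by
    have h1 : HasFDerivAt u d x₀ := (hu.differentiableAt one_ne_zero).hasFDerivAt
    have h2 : HasFDerivAt (fun x : E => ⟪x, e⟫) (innerSL ℝ e) x₀ := by
      simpa [real_inner_comm] using! (innerSL ℝ e).hasFDerivAt (x := x₀)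
    refine (((hasFDerivAt_id x₀).sub (h2.smul_const e)).add (h1.smul_const e)).congr_fderiv ?_
    ext h
    simp [L, sub_smul]
    abel
  have hΦc : ContDiffAt ℝ 1 Φ x₀ :=
    (contDiffAt_id.sub ((contDiffAt_id.inner ℝ contDiffAt_const).smul contDiffAt_const)).add
      (hu.smul contDiffAt_const)
  set F := hΦc.toOpenPartialHomeomorph Φ hΦd one_ne_zero
  have hx₀F : x₀ ∈ F.source := hΦc.mem_toOpenPartialHomeomorph_source hΦd one_ne_zero
  have hFΦ : ∀ x, F x = Φ x := fun x => rfl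
  have hsymm : ContDiffAt ℝ 1 F.symm (Φ x₀) := hΦc.to_localInverse hΦd one_ne_zero
  obtain ⟨W, hW, hWo, hxW⟩ := eventually_nhds_iff.1 (hsymm.eventually (by simp))
  have hV : ∀ x, x ∈ ((F.restrOpen Ω hΩ).symm.restrOpen W hWo).target ↔
      x ∈ F.source ∧ x ∈ Ω ∧ Φ x ∈ W := by
    intro x
    simp [hFΦ, and_assoc]
  have hU : ∀ z, z ∈ ((F.restrOpen Ω hΩ).symm.restrOpen W hWo).source ↔
      z ∈ F.target ∧ F.symm z ∈ Ω ∧ z ∈ W := by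
    intro z
    simp [and_assoc]
  refine ⟨((F.restrOpen Ω hΩ).symm.restrOpen W hWo).target, OpenPartialHomeomorph.open_target _,
    (hV x₀).2 ⟨hx₀F, hx₀, hxW⟩, fun x hx => ((hV x).1 hx).2.1,
    (fun y => y + c • e) ⁻¹' ((F.restrOpen Ω hΩ).symm.restrOpen W hWo).source,
    (OpenPartialHomeomorph.open_source _).preimage (by fun_prop),
    fun y => ⟪F.symm (y + c • e), e⟫, ?_, ?_⟩
  · intro y hy
    have h1 : ContDiffAt ℝ 1 F.symm (y + c • e) := hW _ ((hU _).1 hy.1).2.2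
    have h2 : ContDiffAt ℝ 1 (fun y : E => y + c • e) y := contDiffAt_id.add contDiffAt_const
    exact ((h1.comp y h2).inner ℝ contDiffAt_const).contDiffWithinAt
  · ext p
    simp only [mem_inter_iff, mem_ofPred_eq, and_congr_left_iff, mem_preimage]
    intro hp
    obtain ⟨hpF, hpΩ, hpW⟩ := (hV p).1 hp
    constructor
    · rintro ⟨-, hpc⟩
      have hΦp : p - ⟪p, e⟫ • e + c • e = Φ p := by simp [hΦ, hpc]
      have hinv : F.symm (Φ p) = p := F.left_inv hpF
      refine ⟨p - ⟪p, e⟫ • e, ⟨?_, ?_⟩, ?_⟩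
      · rw [hΦp, hU, hinv]
        exact ⟨F.map_source hpF, hpΩ, hpW⟩
      · simp [inner_sub_left, real_inner_smul_left, he]
      · rw [hΦp, hinv]
        abel
    · rintro ⟨y, ⟨hyU, hye⟩, hpy⟩
      have hye' : ⟪y + c • e, e⟫ = c := by
        simp [inner_add_left, real_inner_smul_left, he, hye]
      set q := F.symm (y + c • e)
      have hΦq : Φ q = y + c • e := F.right_inv ((hU _).1 hyU).1
      have huq : u q = c := by rw [← hΦe, hΦq, hye']
      have hpq : p = q := by
        have : q - ⟪q, e⟫ • e = y := by simpa [hΦ, huq] using hΦq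
        rw [hpy, ← this]
        abel
      exact ⟨hpΩ, hpq ▸ huq⟩

/-- A function with a positive Laplacian at a point has no local maximum there. -/
theorem not_isLocalMax_of_lap_pos {N : ℕ} {w : EuclideanSpace ℝ (Fin N) → ℝ}
    {q : EuclideanSpace ℝ (Fin N)} (hw : ∀ᶠ x in 𝓝 q, DifferentiableAt ℝ w x)
    (hw2 : DifferentiableAt ℝ (fderiv ℝ w) q) (hpos : 0 < lap w q) : ¬ IsLocalMax w q := by
  intro hmax
  obtain ⟨i, -, hi⟩ := Finset.exists_lt_of_sum_lt (s := Finset.univ) (f := fun _ : Fin N => (0 : ℝ))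
    (by simpa [lap] using hpos)
  set a : EuclideanSpace ℝ (Fin N) := EuclideanSpace.single i 1
  set g : ℝ → EuclideanSpace ℝ (Fin N) := fun s => q + s • a with hg
  have hgd : ∀ s, HasDerivAt g a s := fun s => by
    simpa [hg] using! ((hasDerivAt_id s).smul_const a)
  have hg0 : g 0 = q := by simp [hg]
  have hgt : Tendsto g (𝓝 0) (𝓝 q) := hg0 ▸ (hgd 0).continuousAt
  have hd : deriv (w ∘ g) =ᶠ[𝓝 0] fun s => fderiv ℝ w (g s) a := by
    filter_upwards [hgt.eventually hw] with s hs
    exact (hs.hasFDerivAt.comp_hasDerivAt s (hgd s)).deriv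
  have hdd : deriv (deriv (w ∘ g)) 0 = fderiv ℝ (fderiv ℝ w) q a a := by
    rw [hd.deriv_eq]
    have h1 : HasDerivAt (fun s => fderiv ℝ w (g s)) (fderiv ℝ (fderiv ℝ w) q a) 0 := by
      refine HasFDerivAt.comp_hasDerivAt (l := fderiv ℝ w) 0 ?_ (hgd 0)
      rw [hg0]
      exact hw2.hasFDerivAt
    simpa using (h1.clm_apply (hasDerivAt_const (0 : ℝ) a)).deriv
  have hmax' : IsLocalMax (w ∘ g) 0 := by
    have := hgt.eventually hmax
    simpa [IsLocalMax, IsMaxFilter, hg0] using this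
  have hmin : IsLocalMin (w ∘ g) 0 := by
    refine isLocalMin_of_deriv_deriv_pos (hdd ▸ hi) hmax'.deriv_eq_zero ?_
    exact ContinuousAt.comp (by rw [hg0]; exact hw.self_of_nhds.continuousAt) (hgd 0).continuousAt
  have hconst : w ∘ g =ᶠ[𝓝 0] fun _ => (w ∘ g) 0 := by
    filter_upwards [hmax', hmin] with s h1 h2 using le_antisymm h1 h2
  have : deriv (deriv (w ∘ g)) 0 = 0 := by
    rw [(hconst.deriv).deriv_eq]
    simp
  rw [hdd] at this
  exact hi.ne' this

theorem lap_add {N : ℕ} {f g : EuclideanSpace ℝ (Fin N) → ℝ} {x : EuclideanSpace ℝ (Fin N)}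
    (hf : ∀ᶠ z in 𝓝 x, DifferentiableAt ℝ f z) (hg : ∀ᶠ z in 𝓝 x, DifferentiableAt ℝ g z)
    (hf2 : DifferentiableAt ℝ (fderiv ℝ f) x) (hg2 : DifferentiableAt ℝ (fderiv ℝ g) x) :
    DifferentiableAt ℝ (fderiv ℝ (f + g)) x ∧ lap (f + g) x = lap f x + lap g x := by
  have h : fderiv ℝ (f + g) =ᶠ[𝓝 x] fderiv ℝ f + fderiv ℝ g := by
    filter_upwards [hf, hg] with z h1 h2 using fderiv_add h1 h2
  refine ⟨(hf2.add hg2).congr_of_eventuallyEq h, ?_⟩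
  rw [lap, lap, lap, ← Finset.sum_add_distrib, h.fderiv_eq, fderiv_add hf2 hg2]
  rfl

/-- The real inner product as a continuous `ℝ`-bilinear map. -/
noncomputable def realInnerCLM (E : Type*) [NormedAddCommGroup E] [InnerProductSpace ℝ E] :
    E →L[ℝ] E →L[ℝ] ℝ :=
  innerSL ℝ

@[simp]
theorem realInnerCLM_apply {E : Type*} [NormedAddCommGroup E] [InnerProductSpace ℝ E] (x y : E) :
    realInnerCLM E x y = ⟪x, y⟫ :=
  rfl

/-- The quadratic barrier used in the Hopf boundary lemma on a half-space with inner unit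
normal `e` at `y`. -/
noncomputable def halfSpaceBarrier {N : ℕ} (y e x : EuclideanSpace ℝ (Fin N)) : ℝ :=
  ⟪x - y, e⟫ + (N + 1) * ⟪x - y, e⟫ ^ 2 - ‖x - y‖ ^ 2

theorem hasFDerivAt_halfSpaceBarrier {N : ℕ} (y e x : EuclideanSpace ℝ (Fin N)) :
    HasFDerivAt (halfSpaceBarrier y e)
      (innerSL ℝ e + (2 * (N + 1) * ⟪x - y, e⟫) • innerSL ℝ e - (2 : ℝ) • innerSL ℝ (x - y)) x := by
  have h0 : HasFDerivAt (fun x : EuclideanSpace ℝ (Fin N) => x - y)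
      (ContinuousLinearMap.id ℝ _) x := (hasFDerivAt_id x).sub_const y
  have h1 : HasFDerivAt (fun x => ⟪x - y, e⟫) (innerSL ℝ e) x := by
    have := (innerSL ℝ e).hasFDerivAt.comp x h0
    simpa [Function.comp_def, real_inner_comm] using! this
  have h2 := h0.norm_sq
  refine ((h1.add ((h1.pow 2).const_mul ((N : ℝ) + 1))).sub h2).congr_fderiv ?_
  ext z
  simp
  ring

theorem hasFDerivAt_fderiv_halfSpaceBarrier {N : ℕ} (y e x : EuclideanSpace ℝ (Fin N)) :
    HasFDerivAt (fderiv ℝ (halfSpaceBarrier y e))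
      ((2 * ((N : ℝ) + 1)) • (innerSL ℝ e).smulRight (innerSL ℝ e) - (2 : ℝ) • realInnerCLM _) x := by
  have h0 : HasFDerivAt (fun x : EuclideanSpace ℝ (Fin N) => x - y)
      (ContinuousLinearMap.id ℝ _) x := (hasFDerivAt_id x).sub_const y
  have h1 : HasFDerivAt (fun x => ⟪x - y, e⟫) (innerSL ℝ e) x := by
    have := (innerSL ℝ e).hasFDerivAt.comp x h0
    simpa [Function.comp_def, real_inner_comm] using! this
  rw [funext fun x => (hasFDerivAt_halfSpaceBarrier y e x).fderiv]
  refine ((((h1.const_mul (2 * ((N : ℝ) + 1))).smul_const (innerSL ℝ e)).const_add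
    (innerSL ℝ e)).sub (((realInnerCLM _).hasFDerivAt.comp x h0).const_smul (2 : ℝ))).congr_fderiv ?_
  ext z w
  simp [mul_assoc]

theorem lap_halfSpaceBarrier {N : ℕ} (y x : EuclideanSpace ℝ (Fin N))
    {e : EuclideanSpace ℝ (Fin N)} (he : ‖e‖ = 1) : lap (halfSpaceBarrier y e) x = 2 := by
  have hsum : ∑ i, e i * e i = 1 := by
    have := EuclideanSpace.real_norm_sq_eq e
    rw [he] at this
    simpa [sq] using this.symm
  rw [lap, (hasFDerivAt_fderiv_halfSpaceBarrier y e x).fderiv]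
  simp [EuclideanSpace.inner_single_right, ← Finset.mul_sum, hsum, Finset.sum_sub_distrib]
  ring

/-- **Hopf boundary lemma** on a half-space: a `C¹` function which is subharmonic and smaller than
`u y` on the part of a ball around `y` lying in the open half-space with inner unit normal `e`
at `y` has negative derivative at `y` in the direction `e`. -/
theorem fderiv_neg_of_lap_nonneg_of_lt {N : ℕ} {u : EuclideanSpace ℝ (Fin N) → ℝ}
    {y e : EuclideanSpace ℝ (Fin N)} (he : ‖e‖ = 1) {R : ℝ} (hR : 0 < R)
    (hd : ∀ x ∈ Metric.ball y R, DifferentiableAt ℝ u x)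
    (hlt : ∀ x ∈ Metric.ball y R, 0 < ⟪x - y, e⟫ → u x < u y)
    (hlap : ∀ x ∈ Metric.ball y R, 0 < ⟪x - y, e⟫ →
      DifferentiableAt ℝ (fderiv ℝ u) x ∧ 0 ≤ lap u x) :
    fderiv ℝ u y e < 0 := by
  have hee : ⟪e, e⟫ = 1 := by rw [real_inner_self_eq_norm_sq, he]; norm_num
  have hray : ∀ (x : EuclideanSpace ℝ (Fin N)) (s : ℝ), ⟪x + s • e - y, e⟫ = ⟪x - y, e⟫ + s := by
    intro x s
    rw [add_sub_right_comm, inner_add_left, real_inner_smul_left, hee, mul_one]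
  have hrayd : ∀ x s, HasDerivAt (fun s : ℝ => x + s • e) e s := fun x s => by
    simpa using! ((hasDerivAt_id s).smul_const e).const_add x
  have hle : ∀ x ∈ Metric.ball y R, 0 ≤ ⟪x - y, e⟫ → u x ≤ u y := by
    intro x hx hx0
    have hlim : Tendsto (fun s : ℝ => x + s • e) (𝓝[>] 0) (𝓝 x) := by
      have := (hrayd x 0).continuousAt.tendsto
      rw [zero_smul, add_zero] at this
      exact this.mono_left nhdsWithin_le_nhds
    refine le_of_tendsto ((hd x hx).continuousAt.tendsto.comp hlim) ?_
    filter_upwards [hlim.eventually (Metric.isOpen_ball.mem_nhds hx), self_mem_nhdsWithin]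
      with s hs hs0
    refine (hlt _ hs ?_).le
    rw [hray]
    exact add_pos_of_nonneg_of_pos hx0 hs0
  obtain ⟨ρ, hρ0, hρR⟩ := exists_between hR
  have hball : Metric.closedBall y ρ ⊆ Metric.ball y R := Metric.closedBall_subset_ball hρR
  obtain ⟨h, hh0, hh1, hhρ, hhN⟩ : ∃ h : ℝ, 0 < h ∧ h ≤ 1 ∧ h ≤ ρ ∧ (N + 2) * h ≤ ρ ^ 2 := by
    refine ⟨min 1 (min ρ (ρ ^ 2 / (N + 2))), by positivity, min_le_left _ _,
      (min_le_right _ _).trans (min_le_left _ _), ?_⟩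
    rw [← le_div_iff₀' (by positivity)]
    exact (min_le_right _ _).trans (min_le_right _ _)
  have hcont : ContinuousOn u (Metric.closedBall y ρ) := fun x hx =>
    (hd x (hball hx)).continuousAt.continuousWithinAt
  have htc : Continuous fun x : EuclideanSpace ℝ (Fin N) => ⟪x - y, e⟫ := by fun_prop
  have hvc : Continuous (halfSpaceBarrier y e) := by
    unfold halfSpaceBarrier
    fun_prop
  obtain ⟨p, ⟨hpρ, hpt⟩, hpmax⟩ := ((isCompact_closedBall y ρ).inter_right
    ((isClosed_singleton (x := h)).preimage htc)).exists_isMaxOn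
    ⟨y + h • e, by simp [norm_smul, he, abs_of_pos hh0, hhρ],
      by simp [real_inner_smul_left, he]⟩ (hcont.mono inter_subset_left)
  have hpt' : ⟪p - y, e⟫ = h := hpt
  have hp : u p < u y := hlt p (hball hpρ) (by rw [hpt']; exact hh0)
  have hH : 0 < h + (N + 1) * h ^ 2 := by positivity
  have hHρ : h + (N + 1) * h ^ 2 ≤ ρ ^ 2 := by
    have : h ^ 2 ≤ h := by nlinarith
    nlinarith [Nat.cast_nonneg (α := ℝ) N]
  obtain ⟨ε, hε, hεH⟩ : ∃ ε : ℝ, 0 < ε ∧ ε * (h + (N + 1) * h ^ 2) = u y - u p :=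
    ⟨(u y - u p) / (h + (N + 1) * h ^ 2), div_pos (by linarith) hH, by field_simp⟩
  set v : EuclideanSpace ℝ (Fin N) → ℝ := ε • halfSpaceBarrier y e with hv
  have hvd : ∀ x, HasFDerivAt v _ x := fun x =>
    (hasFDerivAt_halfSpaceBarrier y e x).const_smul ε
  have hvH : ∀ x, 0 ≤ ⟪x - y, e⟫ → ⟪x - y, e⟫ ≤ h →
      halfSpaceBarrier y e x ≤ h + (N + 1) * h ^ 2 - ‖x - y‖ ^ 2 := by
    intro x h0 h1
    unfold halfSpaceBarrier
    gcongr
  set D : Set (EuclideanSpace ℝ (Fin N)) :=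
    Metric.closedBall y ρ ∩ (fun x => ⟪x - y, e⟫) ⁻¹' Icc 0 h
  have hmain : ∀ x ∈ D, (u + v) x ≤ u y := by
    obtain ⟨q, ⟨hqρ, hq0, hqh⟩, hqmax⟩ := ((isCompact_closedBall y ρ).inter_right
      (isClosed_Icc.preimage htc)).exists_isMaxOn
      (s := D) (f := u + v) ⟨y, by simpa using hρ0.le, by simpa using hh0.le⟩
      ((hcont.mono inter_subset_left).add (hvc.const_smul ε).continuousOn)
    refine fun x hx => (hqmax hx).trans ?_
    have hq0' : 0 ≤ ⟪q - y, e⟫ := hq0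
    have hqh' : ⟪q - y, e⟫ ≤ h := hqh
    have hqle := hle q (hball hqρ) hq0
    have hvq : v q = ε * halfSpaceBarrier y e q := rfl
    simp only [Pi.add_apply]
    rcases hq0'.eq_or_lt with h0 | h0
    · have : halfSpaceBarrier y e q ≤ 0 := by
        simp [halfSpaceBarrier, ← h0]
      nlinarith
    rcases hqh'.eq_or_lt with h1 | h1
    · have h2 : u q ≤ u p := hpmax ⟨hqρ, h1⟩
      have h3 := hvH q hq0 hqh
      nlinarith [sq_nonneg ‖q - y‖]
    rcases (Metric.mem_closedBall.1 hqρ).eq_or_lt with h2 | h2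
    · have h3 := hvH q hq0 hqh
      rw [← dist_eq_norm, h2] at h3
      nlinarith
    · exfalso
      obtain ⟨hu2, hul⟩ := hlap q (hball hqρ) h0
      have hfv : fderiv ℝ v = ε • fderiv ℝ (halfSpaceBarrier y e) := by
        ext1 x
        exact fderiv_const_smul (hasFDerivAt_halfSpaceBarrier y e x).differentiableAt ε
      have hv2 := (hasFDerivAt_fderiv_halfSpaceBarrier y e q).differentiableAt
      have hud : ∀ᶠ x in 𝓝 q, DifferentiableAt ℝ u x :=
        mem_of_superset (Metric.isOpen_ball.mem_nhds (hball hqρ)) hd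
      have hvd' : ∀ᶠ x in 𝓝 q, DifferentiableAt ℝ v x :=
        .of_forall fun x => (hvd x).differentiableAt
      have hlv : lap v q = ε * 2 := by
        rw [← lap_halfSpaceBarrier y q he, lap, lap, hfv, fderiv_const_smul hv2 ε,
          Finset.mul_sum]
        rfl
      obtain ⟨hw2, hwl⟩ := lap_add hud hvd' hu2 (by rw [hfv]; exact hv2.const_smul ε)
      refine not_isLocalMax_of_lap_pos (hud.mp (hvd'.mono fun x h1 h2 => h2.add h1)) hw2 ?_
        (hqmax.isLocalMax ?_)
      · rw [hwl, hlv]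
        positivity
      · exact inter_mem (Metric.closedBall_mem_nhds_of_mem h2)
          (htc.continuousAt.preimage_mem_nhds (Icc_mem_nhds h0 h1))
  have hvy : v y = 0 := by simp [hv, halfSpaceBarrier]
  have hder : HasDerivAt (fun s : ℝ => (u + v) (y + s • e)) (fderiv ℝ u y e + ε) 0 := by
    have h1 := (hd y (Metric.mem_ball_self hR)).hasFDerivAt.add (hvd y)
    have h2 := HasFDerivAt.comp_hasDerivAt (l := u + v) (f := fun s : ℝ => y + s • e) 0
      (by simpa using! h1) (hrayd y 0)
    simpa [he] using! h2
  have hnonpos : fderiv ℝ u y e + ε ≤ 0 := by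
    refine le_of_tendsto hder.tendsto_slope_zero_right ?_
    filter_upwards [Ioc_mem_nhdsGT hh0] with s hs
    refine mul_nonpos_of_nonneg_of_nonpos (inv_nonneg.2 hs.1.le) (sub_nonpos.2 ?_)
    have : (u + v) (y + s • e) ≤ u y := by
      refine hmain _ ⟨?_, ?_⟩
      · simp [norm_smul, he, abs_of_pos hs.1, hs.2.trans hhρ]
      · rw [mem_preimage, hray, sub_self, inner_zero_left, zero_add]
        exact ⟨hs.1.le, hs.2⟩
    simpa [hvy] using this
  linarith

/-- At a boundary point of a convex set containing the superlevel set `{μᵢ ≤ u}`, a solution has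
nonvanishing gradient on its free boundary `{u = μᵢ}`. -/
theorem fderiv_ne_zero_of_notMem_interior {N n : ℕ} {Ω K : Set (EuclideanSpace ℝ (Fin N))}
    [Nontrivial (EuclideanSpace ℝ (Fin N))] (hΩ : IsOpen Ω) (μ : Fin n → ℝ)
    {u : EuclideanSpace ℝ (Fin N) → ℝ} (hu : ContDiffOn ℝ 1 u Ω)
    (heq : ∀ x ∈ Ω, (∀ i, u x ≠ μ i) → DifferentiableAt ℝ (fderiv ℝ u) x ∧
      lap u x = (Finset.univ.filter fun i => μ i < u x).card)
    (hK : Convex ℝ K) {i : Fin n} (hKi : ∀ x ∈ Ω, μ i ≤ u x → x ∈ K)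
    {y : EuclideanSpace ℝ (Fin N)} (hy : y ∈ Ω) (huy : u y = μ i) (hyK : y ∉ interior K) :
    fderiv ℝ u y ≠ 0 := by
  obtain ⟨e, he, hsupp⟩ := hK.exists_unit_inner_sub_nonpos hyK
  have hcont : ContinuousAt u y := hu.continuousOn.continuousAt (hΩ.mem_nhds hy)
  have hev : ∀ᶠ x in 𝓝 y, x ∈ Ω ∧ ∀ j, μ j < μ i → μ j < u x := by
    refine (hΩ.eventually_mem hy).and (eventually_all.2 fun j => ?_)
    by_cases hj : μ j < μ i
    · filter_upwards [hcont.eventually (lt_mem_nhds (huy ▸ hj))] with x hx _ using hx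
    · exact .of_forall fun x h => absurd h hj
  obtain ⟨R, hR, hball⟩ := Metric.eventually_nhds_iff_ball.1 hev
  have hlt : ∀ x ∈ Metric.ball y R, 0 < ⟪x - y, e⟫ → u x < μ i := fun x hx hx0 =>
    not_le.1 fun h => (hsupp x (hKi x (hball x hx).1 h)).not_gt hx0
  have hneg : fderiv ℝ u y e < 0 := by
    refine fderiv_neg_of_lap_nonneg_of_lt he hR (fun x hx =>
      (hu.contDiffAt (hΩ.mem_nhds (hball x hx).1)).differentiableAt one_ne_zero)
      (huy ▸ hlt) fun x hx hx0 => ?_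
    obtain ⟨h1, h2⟩ := heq x (hball x hx).1 fun j hj => by
      rcases lt_or_ge (μ j) (μ i) with h | h
      · exact ((hball x hx).2 j h).ne' hj
      · exact (hj ▸ hlt x hx hx0).not_ge h
    exact ⟨h1, h2 ▸ Nat.cast_nonneg _⟩
  intro h0
  simp [h0] at hneg

/-- A ray starting in the interior of a bounded set leaves this interior through a point of the
closure. -/
theorem exists_ray_exit {E : Type*} [NormedAddCommGroup E] [NormedSpace ℝ E] {K : Set E}
    (hK : Bornology.IsBounded K) {x e : E} (hx : x ∈ interior K) (he : ‖e‖ = 1) :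
    ∃ T : ℝ, 0 < T ∧ (∀ t, 0 ≤ t → t < T → x + t • e ∈ interior K) ∧
      x + T • e ∉ interior K ∧ x + T • e ∈ closure K := by
  set S : Set ℝ := Ici 0 ∩ (fun t : ℝ => x + t • e) ⁻¹' (interior K)ᶜ
  have hc : Continuous fun t : ℝ => x + t • e := by fun_prop
  have hSc : IsClosed S := isClosed_Ici.inter (isOpen_interior.isClosed_compl.preimage hc)
  have hSb : BddBelow S := ⟨0, fun t ht => ht.1⟩
  have hSn : S.Nonempty := by
    obtain ⟨r, hr⟩ := hK.subset_closedBall x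
    refine ⟨max 0 (r + 1), mem_Ici.2 (le_max_left _ _), fun h => ?_⟩
    have h1 := hr (interior_subset h)
    rw [Metric.mem_closedBall, dist_eq_norm, add_sub_cancel_left, norm_smul, he, mul_one,
      Real.norm_eq_abs] at h1
    linarith [le_abs_self (max 0 (r + 1)), le_max_right 0 (r + 1)]
  have hT := hSc.csInf_mem hSn hSb
  have hlt : ∀ t, 0 ≤ t → t < sInf S → x + t • e ∈ interior K := fun t h0 h => by
    by_contra hn
    exact (csInf_le hSb ⟨h0, hn⟩).not_gt h
  have hT0 : 0 < sInf S := by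
    refine lt_of_le_of_ne hT.1 fun h => hT.2 ?_
    simpa [← h] using hx
  refine ⟨sInf S, hT0, hlt, hT.2, ?_⟩
  refine mem_closure_of_tendsto (hc.continuousAt.tendsto.mono_left
    (nhdsWithin_le_nhds (s := Iio (sInf S)))) ?_
  filter_upwards [Ioo_mem_nhdsLT hT0] with t ht using interior_subset (hlt t ht.1.le ht.2)

/-- If the sets `A ∪ {s ≤ u}` are convex for `c < s < M`, so is `A ∪ {c < u}`. -/
theorem convex_union_strict_superlevel {E : Type*} [AddCommGroup E] [Module ℝ E] {A Ω : Set E}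
    {u : E → ℝ} {c M : ℝ} (hcM : c < M)
    (h : ∀ s ∈ Ioo c M, Convex ℝ (A ∪ {x ∈ Ω | s ≤ u x})) :
    Convex ℝ (A ∪ {x ∈ Ω | c < u x}) := by
  have hex : ∀ x ∈ A ∪ {x ∈ Ω | c < u x}, ∃ s ∈ Ioo c M, x ∈ A ∪ {x ∈ Ω | s ≤ u x} := by
    rintro x (hx | ⟨hx, hux⟩)
    · obtain ⟨s, hs⟩ := exists_between hcM
      exact ⟨s, hs, Or.inl hx⟩
    · obtain ⟨s, hs⟩ := exists_between (lt_min hux hcM)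
      exact ⟨s, ⟨hs.1, hs.2.trans_le (min_le_right _ _)⟩,
        Or.inr ⟨hx, (hs.2.trans_le (min_le_left _ _)).le⟩⟩
  have hanti : ∀ s t, s ≤ t → A ∪ {x ∈ Ω | t ≤ u x} ⊆ A ∪ {x ∈ Ω | s ≤ u x} := fun s t hst =>
    union_subset_union_right _ fun x hx => ⟨hx.1, hst.trans hx.2⟩
  intro x hx y hy a b ha hb hab
  obtain ⟨s, hs, hxs⟩ := hex x hx
  obtain ⟨t, ht, hyt⟩ := hex y hy
  have hm : min s t ∈ Ioo c M := ⟨lt_min hs.1 ht.1, (min_le_left _ _).trans_lt hs.2⟩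
  refine union_subset_union_right A (fun z hz => ?_)
    (h _ hm (hanti _ _ (min_le_left _ _) hxs) (hanti _ _ (min_le_right _ _) hyt) ha hb hab)
  exact ⟨hz.1, hm.1.trans_le hz.2⟩

/-- Proposition 2.2: for a solution `u` of problem (1) in the convex ring
`Ω = Ω₂ \ closure Ω₁` with convex superlevel sets, each free boundary
`Γ_{μᵢ}(u) = {x ∈ Ω : u x = μᵢ}` is locally the graph of a `C¹` function over an open
subset of a hyperplane `e^⊥`. -/
theorem stmt4 (N n : ℕ) (hN : 2 ≤ N)
    (Ω₁ Ω₂ : Set (EuclideanSpace ℝ (Fin N)))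
    (hΩ₁o : IsOpen Ω₁) (hΩ₂o : IsOpen Ω₂)
    (hΩ₁b : Bornology.IsBounded Ω₁) (hΩ₂b : Bornology.IsBounded Ω₂)
    (hΩ₁c : Convex ℝ Ω₁) (hΩ₂c : Convex ℝ Ω₂)
    (hsub : closure Ω₁ ⊆ Ω₂)
    (M : ℝ) (hM : 0 < M)
    (μ : Fin n → ℝ) (hμmono : StrictMono μ)
    (hμ0 : ∀ i, 0 < μ i) (hμM : ∀ i, μ i < M)
    (u : EuclideanSpace ℝ (Fin N) → ℝ)
    (hu_cont : ContinuousOn u (closure (Ω₂ \ closure Ω₁)))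
    (hu1 : ContDiffOn ℝ 1 u (Ω₂ \ closure Ω₁))
    (hHolder : ∃ α : NNReal, 0 < α ∧ (α : ℝ) < 1 ∧
      ∃ C : NNReal, HolderOnWith C α (fderiv ℝ u) (Ω₂ \ closure Ω₁))
    (hbd2 : ∀ x ∈ frontier Ω₂, u x = 0)
    (hbd1 : ∀ x ∈ frontier Ω₁, u x = M)
    (heq : ∀ x ∈ Ω₂ \ closure Ω₁, (∀ i, u x ≠ μ i) →
      DifferentiableAt ℝ (fderiv ℝ u) x ∧
      lap u x = (Finset.univ.filter fun i => μ i < u x).card)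
    (hconv : ∀ s ∈ Set.Ioo (0 : ℝ) M,
      Convex ℝ (closure Ω₁ ∪ {x ∈ Ω₂ \ closure Ω₁ | s ≤ u x})) :
    ∀ i : Fin n, ∀ x₀ ∈ {x ∈ Ω₂ \ closure Ω₁ | u x = μ i},
      ∃ V : Set (EuclideanSpace ℝ (Fin N)), IsOpen V ∧ x₀ ∈ V ∧ V ⊆ Ω₂ \ closure Ω₁ ∧
      ∃ e : EuclideanSpace ℝ (Fin N), ‖e‖ = 1 ∧
      ∃ D : Set (EuclideanSpace ℝ (Fin N)),
        -- D is an open subset of the hyperplane e^⊥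
        (∃ U : Set (EuclideanSpace ℝ (Fin N)), IsOpen U ∧
          D = U ∩ {y : EuclideanSpace ℝ (Fin N) | ⟪y, e⟫ = 0}) ∧
      ∃ ψ : EuclideanSpace ℝ (Fin N) → ℝ, ContDiffOn ℝ 1 ψ D ∧
        {x ∈ Ω₂ \ closure Ω₁ | u x = μ i} ∩ V
          = {p : EuclideanSpace ℝ (Fin N) | ∃ y ∈ D, p = y + ψ y • e} ∩ V := by
  intro i x₀ hx₀
  obtain ⟨hx₀Ω, hux₀⟩ := hx₀
  have : NeZero N := ⟨by omega⟩
  have hΩ : IsOpen (Ω₂ \ closure Ω₁) := hΩ₂o.sdiff isClosed_closure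
  set Ω := Ω₂ \ closure Ω₁
  have hK : Convex ℝ (closure Ω₁ ∪ {x ∈ Ω | μ i ≤ u x}) := hconv _ ⟨hμ0 i, hμM i⟩
  set K := closure Ω₁ ∪ {x ∈ Ω | μ i ≤ u x} with hKdef
  have hKi : ∀ x ∈ Ω, μ i ≤ u x → x ∈ K := fun x hx h => Or.inr ⟨hx, h⟩
  have hgrad : ∀ y ∈ Ω, u y = μ i → y ∉ interior K → fderiv ℝ u y ≠ 0 := fun y hy huy hyK =>
    fderiv_ne_zero_of_notMem_interior hΩ μ hu1 heq hK hKi hy huy hyK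
  have hx₀K : x₀ ∉ interior K := by
    intro hint
    have hC : Convex ℝ (closure Ω₁ ∪ {x ∈ Ω | μ i < u x}) :=
      convex_union_strict_superlevel (hμM i) fun s hs => hconv s ⟨(hμ0 i).trans hs.1, hs.2⟩
    obtain ⟨e, he, hsupp⟩ := hC.exists_unit_inner_sub_nonpos (x := x₀) fun h => by
      rcases interior_subset h with h | h
      · exact hx₀Ω.2 h
      · exact h.2.ne' hux₀
    have hee : ⟪e, e⟫ = 1 := by rw [real_inner_self_eq_norm_sq, he]; norm_num
    have hKΩ₂ : K ⊆ Ω₂ := union_subset hsub fun x hx => hx.1.1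
    obtain ⟨T, hT0, hTlt, hTK, hTcl⟩ := exists_ray_exit (hΩ₂b.subset hKΩ₂) hint he
    set y := x₀ + T • e
    have hnot : ∀ x, 0 < ⟪x - x₀, e⟫ → x ∉ closure Ω₁ ∧ (x ∈ Ω → u x ≤ μ i) := fun x hx =>
      ⟨fun h => (hsupp x (Or.inl h)).not_gt hx,
        fun hxΩ => not_lt.1 fun h => (hsupp x (Or.inr ⟨hxΩ, h⟩)).not_gt hx⟩
    have hray : ∀ t : ℝ, ⟪x₀ + t • e - x₀, e⟫ = t := fun t => by
      rw [add_sub_cancel_left, real_inner_smul_left, hee, mul_one]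
    have hy1 : y ∉ closure Ω₁ := (hnot y (by rw [hray]; exact hT0)).1
    have hycl : y ∈ closure {x ∈ Ω | μ i ≤ u x} := by
      rw [hKdef, closure_union, closure_closure] at hTcl
      exact hTcl.resolve_left hy1
    have huy : μ i ≤ u y := by
      have hyΩ : y ∈ closure Ω := closure_mono (sep_subset _ _) hycl
      have hlim := (hu_cont y hyΩ).mono ((sep_subset Ω fun x => μ i ≤ u x).trans subset_closure)
      have := mem_closure_iff_nhdsWithin_neBot.1 hycl
      exact ge_of_tendsto hlim (eventually_nhdsWithin_of_forall fun x hx => hx.2)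
    have hy2 : y ∈ Ω₂ := by
      by_contra hn
      have hfr : y ∈ frontier Ω₂ :=
        ⟨closure_mono hKΩ₂ hTcl, by rwa [hΩ₂o.interior_eq]⟩
      exact (hμ0 i).not_ge (hbd2 y hfr ▸ huy)
    have hyΩ : y ∈ Ω := ⟨hy2, hy1⟩
    have huy' : u y = μ i := le_antisymm ((hnot y (by rw [hray]; exact hT0)).2 hyΩ) huy
    refine hgrad y hyΩ huy' hTK ?_
    have hzero : ∀ t ∈ Ioo 0 T, fderiv ℝ u (x₀ + t • e) = 0 := by
      intro t ht
      have hH : IsOpen {x : EuclideanSpace ℝ (Fin N) | 0 < ⟪x - x₀, e⟫} :=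
        isOpen_lt continuous_const (by fun_prop)
      have hconst : u =ᶠ[𝓝 (x₀ + t • e)] fun _ => μ i := by
        filter_upwards [isOpen_interior.mem_nhds (hTlt t ht.1.le ht.2),
          hH.mem_nhds (by rw [mem_ofPred_eq, hray]; exact ht.1)] with x hxK hxH
        obtain ⟨hxΩ, hux⟩ := (interior_subset hxK).resolve_left (hnot x hxH).1
        exact le_antisymm ((hnot x hxH).2 hxΩ) hux
      rw [hconst.fderiv_eq]
      simp
    have hfc : ContinuousAt (fderiv ℝ u) y :=
      (hu1.continuousOn_fderiv_of_isOpen hΩ le_rfl).continuousAt (hΩ.mem_nhds hyΩ)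
    have hlim : Tendsto (fun t : ℝ => x₀ + t • e) (𝓝[<] T) (𝓝 y) :=
      (Continuous.tendsto (by fun_prop) T).mono_left nhdsWithin_le_nhds
    refine tendsto_nhds_unique (hfc.tendsto.comp hlim) (tendsto_const_nhds.congr' ?_)
    filter_upwards [Ioo_mem_nhdsLT hT0] with t ht using (hzero t ht).symm
  have hne := hgrad x₀ hx₀Ω hux₀ hx₀K
  obtain ⟨a, ha⟩ : ∃ a, fderiv ℝ u x₀ a ≠ 0 := by
    by_contra! h
    exact hne (ContinuousLinearMap.ext h)
  have ha0 : a ≠ 0 := by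
    rintro rfl
    simp at ha
  have he : ‖‖a‖⁻¹ • a‖ = 1 := norm_smul_inv_norm ha0
  obtain ⟨V, hVo, hxV, hVΩ, U, hU, ψ, hψ, hgraph⟩ := exists_levelSet_eq_graph hΩ hx₀Ω
    (hu1.contDiffAt (hΩ.mem_nhds hx₀Ω)) he (by simp [ha, ha0]) (μ i)
  exact ⟨V, hVo, hxV, hVΩ, _, he, _, ⟨U, hU, rfl⟩, ψ, hψ, hgraph⟩
end
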